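/- For PSD operators A and B on a finite-dimensional Hilbert space and any α ∈ [0,1], ½(Tr A + Tr B) − ½‖A − B‖₁ ≤ Tr(A^α B^{1−α}). -/

import Mathlib

open Matrix ComplexOrder

/-- The PSD power `A^α` of a Hermitian matrix, defined via the spectral
decomposition, with the convention `0^α = 0`. -/
noncomputable def hermPow {d : ℕ} (A : Matrix (Fin d) (Fin d) ℂ)
    (hA : A.IsHermitian) (α : ℝ) : Matrix (Fin d) (Fin d) ℂ :=
  (hA.eigenvectorUnitary : Matrix (Fin d) (Fin d) ℂ) *
    Matrix.diagonal (fun i =>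
      ((if hA.eigenvalues i = 0 then (0 : ℝ) else hA.eigenvalues i ^ α : ℝ) : ℂ)) *
    star (hA.eigenvectorUnitary : Matrix (Fin d) (Fin d) ℂ)

section TraceInequalities

open scoped MatrixOrder Matrix.Norms.L2Operator

namespace Matrix

variable {n : Type*} [Fintype n] [DecidableEq n]

theorem trace_mul_nonneg {A B : Matrix n n ℂ} (hA : 0 ≤ A) (hB : 0 ≤ B) :
    0 ≤ (A * B).trace := by
  obtain ⟨X, rfl⟩ := CStarAlgebra.nonneg_iff_eq_star_mul_self.mp hA
  rw [Matrix.mul_assoc, trace_mul_comm]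
  exact (hB.posSemidef.mul_mul_conjTranspose_same X).trace_nonneg

theorem trace_mul_le_trace_mul {A A' B B' : Matrix n n ℂ} (hA : A ≤ A') (hB : B ≤ B')
    (hB₀ : 0 ≤ B) (hA' : 0 ≤ A') : (A * B).trace ≤ (A' * B').trace := by
  have h₁ := trace_mul_nonneg (sub_nonneg.mpr hA) hB₀
  have h₂ := trace_mul_nonneg hA' (sub_nonneg.mpr hB)
  rw [sub_mul, trace_sub, sub_nonneg] at h₁
  rw [mul_sub, trace_sub, sub_nonneg] at h₂
  exact h₁.trans h₂

theorem trace_cfc {A : Matrix n n ℂ} (hA : A.IsHermitian) (f : ℝ → ℝ) :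
    (cfc f A).trace = ∑ i, (f (hA.eigenvalues i) : ℂ) := by
  rw [hA.cfc_eq, IsHermitian.cfc, Unitary.conjStarAlgAut_apply, trace_mul_cycle,
    Unitary.coe_star_mul_self, Matrix.one_mul, trace_diagonal]
  simp

theorem trace_posPart {A : Matrix n n ℂ} (hA : A.IsHermitian) :
    (A⁺).trace = ∑ i, (((hA.eigenvalues i)⁺ : ℝ) : ℂ) := by
  rw [CFC.posPart_def, cfcₙ_eq_cfc, trace_cfc hA]

theorem rpow_mul_rpow_of_add_eq_one {A : Matrix n n ℂ} (hA : 0 ≤ A) {p q : ℝ}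
    (hpq : p + q = 1) : A ^ p * A ^ q = A := by
  have hA' : IsSelfAdjoint A := hA.isSelfAdjoint
  rw [CFC.rpow_eq_cfc_real hA, CFC.rpow_eq_cfc_real hA, ← cfc_mul _ _ A
    (A.finite_real_spectrum.continuousOn _) (A.finite_real_spectrum.continuousOn _)]
  conv_rhs => rw [← cfc_id' ℝ A]
  refine cfc_congr fun x hx => ?_
  have hx₀ : 0 ≤ x := spectrum_nonneg_of_nonneg hA hx
  rw [← Real.rpow_add' hx₀ (by simp [hpq]), hpq, Real.rpow_one]

/-- Ozawa's argument, by operator monotonicity of `x ↦ x ^ p`. -/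
theorem trace_sub_trace_posPart_le {A B : Matrix n n ℂ} (hA : 0 ≤ A) (hB : 0 ≤ B) {p q : ℝ}
    (hp : 0 ≤ p) (hq : 0 ≤ q) (hpq : p + q = 1) :
    A.trace - ((A - B)⁺).trace ≤ (A ^ p * B ^ q).trace := by
  have hAB : IsSelfAdjoint (A - B) := hA.isSelfAdjoint.sub hB.isSelfAdjoint
  set C := B + (A - B)⁺
  have hBC : B ≤ C := le_add_of_nonneg_right (CFC.posPart_nonneg _)
  have hAC : A ≤ C :=
    sub_le_iff_le_add'.mp (CFC.le_posPart hAB)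
  have hp' : p ∈ Set.Icc (0 : ℝ) 1 := ⟨hp, by linarith⟩
  have hq' : q ∈ Set.Icc (0 : ℝ) 1 := ⟨hq, by linarith⟩
  have h₁ := trace_mul_le_trace_mul (sub_le_sub_right (CFC.rpow_le_rpow hq' hAC) (B ^ q))
    (CFC.rpow_le_rpow hp' hAC) CFC.rpow_nonneg
    (sub_nonneg.mpr (CFC.rpow_le_rpow hq' hBC))
  have h₂ := trace_mul_le_trace_mul (le_refl (B ^ q)) (CFC.rpow_le_rpow hp' hBC)
    CFC.rpow_nonneg CFC.rpow_nonneg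
  have hqp : q + p = 1 := by linarith
  rw [sub_mul, sub_mul, rpow_mul_rpow_of_add_eq_one hA hqp,
    rpow_mul_rpow_of_add_eq_one (hB.trans hBC) hqp, trace_sub, trace_sub] at h₁
  rw [rpow_mul_rpow_of_add_eq_one hB hqp] at h₂
  rw [trace_mul_comm (A ^ p)]
  have h₃ : C.trace = B.trace + ((A - B)⁺).trace := trace_add _ _
  rw [h₃] at h₁
  have h := add_le_add h₁ h₂
  rw [← sub_nonneg] at h ⊢
  convert h using 1
  ring

theorem half_trace_add_sub_sum_abs_eigenvalues {A B : Matrix n n ℂ} (hA : A.IsHermitian)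
    (hB : B.IsHermitian) :
    ((1 / 2 * (A.trace.re + B.trace.re)
        - 1 / 2 * ∑ i, |(hA.sub hB).eigenvalues i| : ℝ) : ℂ)
      = A.trace - ((A - B)⁺).trace := by
  have h := (hA.sub hB).trace_eq_sum_eigenvalues
  rw [trace_posPart (hA.sub hB)]
  rw [trace_sub, hA.trace_eq_sum_eigenvalues, hB.trace_eq_sum_eigenvalues] at h
  rw [hA.trace_eq_sum_eigenvalues, hB.trace_eq_sum_eigenvalues]
  norm_cast at h ⊢
  simp only [Complex.coe_algebraMap, RCLike.ofReal_sum] at h ⊢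
  norm_cast at h ⊢
  have habs : ∀ x : ℝ, x⁺ = (x + |x|) / 2 := fun x => by
    linarith [posPart_sub_negPart x, posPart_add_negPart x]
  simp only [habs, ← Finset.sum_div, Finset.sum_add_distrib]
  rw [← h]
  ring

end Matrix

theorem hermPow_eq_rpow {d : ℕ} {A : Matrix (Fin d) (Fin d) ℂ} (hA : A.PosSemidef) {p : ℝ}
    (hp : p ≠ 0) : hermPow A hA.1 p = A ^ p := by
  rw [CFC.rpow_eq_cfc_real hA.nonneg, hA.1.cfc_eq, IsHermitian.cfc,
    Unitary.conjStarAlgAut_apply, hermPow]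
  congr! 4 with i
  by_cases hi : hA.1.eigenvalues i = 0 <;> simp [hi, hp]

theorem continuous_hermPow {d : ℕ} {A : Matrix (Fin d) (Fin d) ℂ} (hA : A.IsHermitian) :
    Continuous (hermPow A hA) := by
  unfold hermPow
  refine (continuous_const.matrix_mul (Continuous.matrix_diagonal
    (continuous_pi fun i => ?_))).matrix_mul continuous_const
  refine Complex.continuous_ofReal.comp ?_
  split_ifs with hi
  · exact continuous_const
  · exact Real.continuous_const_rpow hi

theorem trace_sub_trace_posPart_le_hermPow {d : ℕ} {A B : Matrix (Fin d) (Fin d) ℂ}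
    (hA : A.PosSemidef) (hB : B.PosSemidef) {α : ℝ} (hα : α ∈ Set.Icc (0 : ℝ) 1) :
    A.trace - ((A - B)⁺).trace ≤ (hermPow A hA.1 α * hermPow B hB.1 (1 - α)).trace := by
  have hcont : Continuous fun p : ℝ => (hermPow A hA.1 p * hermPow B hB.1 (1 - p)).trace :=
    ((continuous_hermPow hA.1).mul
      ((continuous_hermPow hB.1).comp (continuous_const.sub continuous_id))).matrix_trace
  have hclosed := isClosed_Ici (a := A.trace - ((A - B)⁺).trace) |>.preimage hcont
  rw [← closure_Ioo zero_ne_one] at hα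
  refine hclosed.closure_subset_iff.mpr (fun p hp => ?_) hα
  rw [Set.mem_preimage, Set.mem_Ici, hermPow_eq_rpow hA hp.1.ne',
    hermPow_eq_rpow hB (sub_pos.mpr hp.2).ne']
  exact Matrix.trace_sub_trace_posPart_le hA.nonneg hB.nonneg hp.1.le
    (sub_pos.mpr hp.2).le (add_sub_cancel p 1)

end TraceInequalities

theorem audenaert_inequality {d : ℕ}
    (A B : Matrix (Fin d) (Fin d) ℂ)
    (hA : A.PosSemidef) (hB : B.PosSemidef)
    (α : ℝ) (hα : α ∈ Set.Icc (0 : ℝ) 1) :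
    ((1 / 2 * (A.trace.re + B.trace.re)
        - 1 / 2 * ∑ i, |(hA.1.sub hB.1).eigenvalues i| : ℝ) : ℂ)
      ≤ (hermPow A hA.1 α * hermPow B hB.1 (1 - α)).trace := by
  rw [Matrix.half_trace_add_sub_sum_abs_eigenvalues hA.1 hB.1]
  exact trace_sub_trace_posPart_le_hermPow hA hB hα
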